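/- Let α, β, γ, A, B, C be positive real numbers. Let (x_n)_{n≥-1} be any sequence with x_{-1}, x_0 ∈ [0,∞) satisfying x_{n+1} = (α + β·x_n + γ·x_{n-1})/(A + B·x_n + C·x_{n-1}) for all n ≥ 0. Then either x_n converges to the unique positive equilibrium x̄ (the unique positive root of (B+C)x² + (A−β−γ)x − α = 0), or there exists a prime period-two solution (φ, ψ) such that the subsequence of even-indexed terms converges to one of φ, ψ and the subsequence of odd-indexed terms converges to the other. -/

import Mathlib

open Filter Topology Set

/-- The even-indexed and the odd-indexed terms of `x` both converge. -/
def ParityConvergent (x : ℕ → ℝ) : Prop :=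
  ∃ φ ψ : ℝ, Tendsto (fun n => x (2 * n)) atTop (𝓝 φ) ∧
    Tendsto (fun n => x (2 * n + 1)) atTop (𝓝 ψ)

lemma ParityConvergent.of_tendsto {x : ℕ → ℝ} {l : ℝ} (h : Tendsto x atTop (𝓝 l)) :
    ParityConvergent x :=
  ⟨l, l, h.comp (tendsto_atTop_mono (fun n => by simp only [id]; omega) tendsto_id),
    h.comp (tendsto_atTop_mono (fun n => by simp only [id]; omega) tendsto_id)⟩

lemma ParityConvergent.of_succ {x : ℕ → ℝ} (h : ParityConvergent fun n => x (n + 1)) :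
    ParityConvergent x := by
  obtain ⟨φ, ψ, h1, h2⟩ := h
  refine ⟨ψ, φ, ?_, h1⟩
  rw [← tendsto_add_atTop_iff_nat 1]
  exact h2

lemma ParityConvergent.of_add {x : ℕ → ℝ} (N : ℕ) (h : ParityConvergent fun n => x (n + N)) :
    ParityConvergent x := by
  induction N with
  | zero => exact h
  | succ k ih =>
    refine ih (ParityConvergent.of_succ ?_)
    simpa only [add_assoc, add_comm 1 k] using h

lemma ParityConvergent.affine {y : ℕ → ℝ} (h : ParityConvergent y) (s t : ℝ) :
    ParityConvergent fun n => s + t * y n := by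
  obtain ⟨φ, ψ, h1, h2⟩ := h
  exact ⟨s + t * φ, s + t * ψ, (h1.const_mul t).const_add s, (h2.const_mul t).const_add s⟩

lemma exists_tendsto_of_le_succ {u : ℕ → ℝ} {b : ℝ} (hb : ∀ n, u n ≤ b)
    (h : ∀ n, u n ≤ u (n + 1)) : ∃ l, Tendsto u atTop (𝓝 l) :=
  ⟨_, tendsto_atTop_ciSup (monotone_nat_of_le_succ h) ⟨b, by rintro _ ⟨n, rfl⟩; exact hb n⟩⟩

lemma exists_tendsto_of_succ_le {u : ℕ → ℝ} {a : ℝ} (ha : ∀ n, a ≤ u n)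
    (h : ∀ n, u (n + 1) ≤ u n) : ∃ l, Tendsto u atTop (𝓝 l) :=
  ⟨_, tendsto_atTop_ciInf (antitone_nat_of_succ_le h) ⟨a, by rintro _ ⟨n, rfl⟩; exact ha n⟩⟩

lemma ParityConvergent.of_monotone {x : ℕ → ℝ} {a b : ℝ} (ha : ∀ n, a ≤ x n) (hb : ∀ n, x n ≤ b)
    (he : (∀ n, x (2 * n) ≤ x (2 * n + 2)) ∨ ∀ n, x (2 * n + 2) ≤ x (2 * n))
    (ho : (∀ n, x (2 * n + 1) ≤ x (2 * n + 3)) ∨ ∀ n, x (2 * n + 3) ≤ x (2 * n + 1)) :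
    ParityConvergent x := by
  have h1 : ∃ φ, Tendsto (fun n => x (2 * n)) atTop (𝓝 φ) := by
    rcases he with he | he
    · exact exists_tendsto_of_le_succ (fun n => hb _) he
    · exact exists_tendsto_of_succ_le (fun n => ha _) he
  have h2 : ∃ ψ, Tendsto (fun n => x (2 * n + 1)) atTop (𝓝 ψ) := by
    rcases ho with ho | ho
    · exact exists_tendsto_of_le_succ (fun n => hb _) ho
    · exact exists_tendsto_of_succ_le (fun n => ha _) ho
  obtain ⟨φ, h1⟩ := h1
  obtain ⟨ψ, h2⟩ := h2
  exact ⟨φ, ψ, h1, h2⟩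

/-- Bounded solutions of a second-order recursion increasing in both arguments. -/
lemma ParityConvergent.of_increasing {x : ℕ → ℝ} {a b : ℝ} (ha : ∀ n, a ≤ x n) (hb : ∀ n, x n ≤ b)
    (hup : ∀ n, x n ≤ x (n + 2) → x (n + 1) ≤ x (n + 3) → x (n + 2) ≤ x (n + 4))
    (hdn : ∀ n, x (n + 2) ≤ x n → x (n + 3) ≤ x (n + 1) → x (n + 4) ≤ x (n + 2)) :
    ParityConvergent x := by
  by_cases h1 : ∃ N, x N ≤ x (N + 2) ∧ x (N + 1) ≤ x (N + 3)
  · obtain ⟨N, hN⟩ := h1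
    have key : ∀ n, x (n + N) ≤ x (n + N + 2) ∧ x (n + N + 1) ≤ x (n + N + 3) := by
      intro n
      induction n with
      | zero => simpa using hN
      | succ n ih =>
        have := hup _ ih.1 ih.2
        rw [show n + 1 + N = n + N + 1 by ring]
        exact ⟨ih.2, this⟩
    refine ParityConvergent.of_add N (ParityConvergent.of_monotone (fun n => ha _) (fun n => hb _)
      (.inl fun n => ?_) (.inl fun n => ?_))
    · rw [show 2 * n + 2 + N = 2 * n + N + 2 by ring]
      exact (key _).1
    · rw [show 2 * n + 1 + N = 2 * n + N + 1 by ring, show 2 * n + 3 + N = 2 * n + N + 3 by ring]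
      exact (key _).2
  by_cases h2 : ∃ N, x (N + 2) ≤ x N ∧ x (N + 3) ≤ x (N + 1)
  · obtain ⟨N, hN⟩ := h2
    have key : ∀ n, x (n + N + 2) ≤ x (n + N) ∧ x (n + N + 3) ≤ x (n + N + 1) := by
      intro n
      induction n with
      | zero => simpa using hN
      | succ n ih =>
        have := hdn _ ih.1 ih.2
        rw [show n + 1 + N = n + N + 1 by ring]
        exact ⟨ih.2, this⟩
    refine ParityConvergent.of_add N (ParityConvergent.of_monotone (fun n => ha _) (fun n => hb _)
      (.inr fun n => ?_) (.inr fun n => ?_))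
    · rw [show 2 * n + 2 + N = 2 * n + N + 2 by ring]
      exact (key _).1
    · rw [show 2 * n + 1 + N = 2 * n + N + 1 by ring, show 2 * n + 3 + N = 2 * n + N + 3 by ring]
      exact (key _).2
  push Not at h1 h2
  have up : ∀ n, x n ≤ x (n + 2) → x (n + 2) ≤ x (n + 4) := fun n h =>
    (h2 (n + 1) (h1 n h).le).le
  have dn : ∀ n, x (n + 2) ≤ x n → x (n + 4) ≤ x (n + 2) := fun n h =>
    (h1 (n + 1) (h2 n h).le).le
  have par : ∀ k, (∀ n, x (2 * n + k) ≤ x (2 * n + k + 2)) ∨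
      ∀ n, x (2 * n + k + 2) ≤ x (2 * n + k) := by
    intro k
    rcases le_total (x k) (x (k + 2)) with h | h
    · refine .inl fun n => ?_
      induction n with
      | zero => simpa using h
      | succ n ih =>
        rw [show 2 * (n + 1) + k = 2 * n + k + 2 by ring]
        exact up _ ih
    · refine .inr fun n => ?_
      induction n with
      | zero => simpa using h
      | succ n ih =>
        rw [show 2 * (n + 1) + k = 2 * n + k + 2 by ring]
        exact dn _ ih
  exact ParityConvergent.of_monotone ha hb (par 0) (par 1)

/-- Bounded solutions of a second-order recursion decreasing in the last term and increasing in
the one before it. -/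
lemma ParityConvergent.of_decreasing_increasing {x : ℕ → ℝ} {a b : ℝ}
    (ha : ∀ n, a ≤ x n) (hb : ∀ n, x n ≤ b)
    (hup : ∀ n, x n ≤ x (n + 2) → x (n + 3) ≤ x (n + 1) → x (n + 2) ≤ x (n + 4))
    (hdn : ∀ n, x (n + 2) ≤ x n → x (n + 1) ≤ x (n + 3) → x (n + 4) ≤ x (n + 2)) :
    ParityConvergent x := by
  by_cases h1 : ∃ N, x N ≤ x (N + 2) ∧ x (N + 3) ≤ x (N + 1)
  · obtain ⟨N, hN⟩ := h1
    have key : ∀ n, x (2 * n + N) ≤ x (2 * n + N + 2) ∧ x (2 * n + N + 3) ≤ x (2 * n + N + 1) := by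
      intro n
      induction n with
      | zero => simpa using hN
      | succ n ih =>
        have h3 := hup _ ih.1 ih.2
        have h4 := hdn _ ih.2 h3
        rw [show 2 * (n + 1) + N = 2 * n + N + 2 by ring]
        exact ⟨h3, h4⟩
    refine ParityConvergent.of_add N (ParityConvergent.of_monotone (fun n => ha _) (fun n => hb _)
      (.inl fun n => ?_) (.inr fun n => ?_))
    · rw [show 2 * n + 2 + N = 2 * n + N + 2 by ring]
      exact (key _).1
    · rw [show 2 * n + 1 + N = 2 * n + N + 1 by ring, show 2 * n + 3 + N = 2 * n + N + 3 by ring]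
      exact (key _).2
  by_cases h2 : ∃ N, x (N + 2) ≤ x N ∧ x (N + 1) ≤ x (N + 3)
  · obtain ⟨N, hN⟩ := h2
    exact absurd ⟨N + 1, hN.2, hdn N hN.1 hN.2⟩ h1
  push Not at h1 h2
  have up : ∀ n, x n ≤ x (n + 2) → x (n + 1) ≤ x (n + 3) := fun n h => (h1 n h).le
  have dn : ∀ n, x (n + 2) ≤ x n → x (n + 3) ≤ x (n + 1) := fun n h => (h2 n h).le
  have par : (∀ n, x n ≤ x (n + 2)) ∨ ∀ n, x (n + 2) ≤ x n := by
    rcases le_total (x 0) (x 2) with h | h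
    · refine .inl fun n => ?_
      induction n with
      | zero => exact h
      | succ n ih => exact up n ih
    · refine .inr fun n => ?_
      induction n with
      | zero => exact h
      | succ n ih => exact dn n ih
  exact ParityConvergent.of_monotone ha hb (par.imp (fun h n => h _) fun h n => h _)
    (par.imp (fun h n => h _) fun h n => h _)

/-- `m` and `M` are the smallest and the largest cluster point of `y`, and `y` is bounded. -/
structure LimitRange (y : ℕ → ℝ) (m M : ℝ) : Prop where
  le : m ≤ M
  eventually_mem : ∀ ε > 0, ∀ᶠ n in atTop, m - ε < y n ∧ y n < M + ε
  cluster_lower : MapClusterPt m atTop y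
  cluster_upper : MapClusterPt M atTop y

lemma exists_limitRange {y : ℕ → ℝ} {a b : ℝ} (ha : ∀ n, a ≤ y n) (hb : ∀ n, y n ≤ b) :
    ∃ m M, LimitRange y m M := by
  have bA : IsBoundedUnder (· ≤ ·) atTop y := isBoundedUnder_of ⟨b, hb⟩
  have bB : IsBoundedUnder (· ≥ ·) atTop y := isBoundedUnder_of ⟨a, ha⟩
  have hM : ∀ ε > 0, ∀ᶠ n in atTop, y n < limsup y atTop + ε := fun ε hε =>
    eventually_lt_of_limsup_lt (by linarith) bA
  have hm : ∀ ε > 0, ∀ᶠ n in atTop, liminf y atTop - ε < y n := fun ε hε =>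
    eventually_lt_of_lt_liminf (by linarith) bB
  refine ⟨liminf y atTop, limsup y atTop, liminf_le_limsup bA bB,
    fun ε hε => (hm ε hε).and (hM ε hε), ?_, ?_⟩
  · rw [mapClusterPt_iff_frequently]
    intro s hs
    obtain ⟨ε, hε, hs⟩ := Metric.mem_nhds_iff.1 hs
    have h1 : ∃ᶠ n in atTop, y n < liminf y atTop + ε :=
      frequently_lt_of_liminf_lt bA.isCoboundedUnder_ge (by linarith)
    refine (h1.and_eventually (hm ε hε)).mono fun n hn => hs ?_
    rw [Metric.mem_ball, Real.dist_eq, abs_lt]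
    constructor <;> linarith [hn.1, hn.2]
  · rw [mapClusterPt_iff_frequently]
    intro s hs
    obtain ⟨ε, hε, hs⟩ := Metric.mem_nhds_iff.1 hs
    have h1 : ∃ᶠ n in atTop, limsup y atTop - ε < y n :=
      frequently_lt_of_lt_limsup bB.isCoboundedUnder_le (by linarith)
    refine (h1.and_eventually (hM ε hε)).mono fun n hn => hs ?_
    rw [Metric.mem_ball, Real.dist_eq, abs_lt]
    constructor <;> linarith [hn.1, hn.2]

lemma LimitRange.ge_of_forall {y : ℕ → ℝ} {m M a : ℝ} (h : LimitRange y m M)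
    (ha : ∀ n, a ≤ y n) : a ≤ m := by
  by_contra! hlt
  have := (mapClusterPt_iff_frequently.1 h.cluster_lower) (Iio a) (Iio_mem_nhds hlt)
  obtain ⟨n, hn⟩ := this.exists
  exact absurd (ha n) (not_le.2 hn)

lemma LimitRange.tendsto {y : ℕ → ℝ} {m M : ℝ} (h : LimitRange y m M) (he : m = M) :
    Tendsto y atTop (𝓝 m) := by
  rw [Metric.tendsto_atTop']
  intro ε hε
  obtain ⟨N, hN⟩ := eventually_atTop.1 (h.eventually_mem ε hε)
  refine ⟨N, fun n hn => ?_⟩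
  have := hN n hn.le
  rw [Real.dist_eq, abs_lt]
  constructor <;> linarith [this.1, this.2]

lemma LimitRange.mem_of_tendsto {y : ℕ → ℝ} {m M p : ℝ} (h : LimitRange y m M) {σ : ℕ → ℕ}
    (hσ : Tendsto σ atTop atTop) (hp : Tendsto (fun k => y (σ k)) atTop (𝓝 p)) :
    p ∈ Icc m M := by
  constructor
  · refine le_of_forall_pos_sub_le fun ε hε => ge_of_tendsto hp ?_
    exact (hσ.eventually (h.eventually_mem ε hε)).mono fun n hn => hn.1.le
  · refine le_of_forall_pos_le_add fun ε hε => le_of_tendsto hp ?_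
    exact (hσ.eventually (h.eventually_mem ε hε)).mono fun n hn => hn.2.le

/-- A cluster point of a bounded sequence can be approached so that the two preceding terms
converge as well. -/
lemma LimitRange.exists_lagged {y : ℕ → ℝ} {m M L : ℝ} (h : LimitRange y m M)
    (hL : MapClusterPt L atTop y) :
    ∃ (σ : ℕ → ℕ) (p q : ℝ), Tendsto σ atTop atTop ∧ p ∈ Icc m M ∧ q ∈ Icc m M ∧
      Tendsto (fun k => y (σ k + 2)) atTop (𝓝 L) ∧
      Tendsto (fun k => y (σ k + 1)) atTop (𝓝 p) ∧ Tendsto (fun k => y (σ k)) atTop (𝓝 q) := by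
  have hL' : MapClusterPt L atTop fun n => y (n + 2) := by
    rw [mapClusterPt_iff_frequently] at hL ⊢
    intro s hs
    have h1 := hL s hs
    rw [frequently_atTop] at h1 ⊢
    intro N
    obtain ⟨n, hn, hy⟩ := h1 (N + 2)
    exact ⟨n - 2, by omega, by rwa [Nat.sub_add_cancel (by omega)]⟩
  obtain ⟨σ₁, hσ₁, h1⟩ := hL'.tendsto_subseq
  obtain ⟨N, hN⟩ := eventually_atTop.1 (h.eventually_mem 1 one_pos)
  have hfr : ∀ (τ : ℕ → ℕ) (i : ℕ), Tendsto τ atTop atTop →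
      ∃ᶠ k in atTop, y (τ k + i) ∈ Icc (m - 1) (M + 1) := fun τ i hτ =>
    ((hτ.eventually_ge_atTop N).mono fun k hk =>
      ⟨(hN _ (by omega)).1.le, (hN _ (by omega)).2.le⟩).frequently
  obtain ⟨p, -, σ₂, hσ₂, h2⟩ :=
    isCompact_Icc.tendsto_subseq' (hfr σ₁ 1 hσ₁.tendsto_atTop)
  obtain ⟨q, -, σ₃, hσ₃, h3⟩ :=
    isCompact_Icc.tendsto_subseq' (hfr (σ₁ ∘ σ₂) 0 (hσ₁.comp hσ₂).tendsto_atTop)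
  have hσ : Tendsto (fun k => σ₁ (σ₂ (σ₃ k))) atTop atTop :=
    (hσ₁.comp (hσ₂.comp hσ₃)).tendsto_atTop
  have h2' : Tendsto (fun k => y (σ₁ (σ₂ (σ₃ k)) + 1)) atTop (𝓝 p) := h2.comp hσ₃.tendsto_atTop
  have h3' : Tendsto (fun k => y (σ₁ (σ₂ (σ₃ k)))) atTop (𝓝 q) := h3
  exact ⟨_, p, q, hσ, h.mem_of_tendsto ((tendsto_add_atTop_nat 1).comp hσ) h2',
    h.mem_of_tendsto hσ h3', h1.comp (hσ₂.comp hσ₃).tendsto_atTop, h2', h3'⟩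

lemma exists_forall_pos_of_mul_eq_add {u d : ℕ → ℝ} {α A s : ℝ} (hα : 0 < α) (hA : 0 < A)
    (hu : ∀ k, u (k + 1) * d k = α + u k) (hd : ∀ k, A ≤ d k) (hs : ∀ k, -s ≤ u k)
    (h : 0 < α - s * (1 - A)) : ∃ K, ∀ k ≥ K, 0 < u k := by
  have step : ∀ k, 0 < α + u k → 0 < u (k + 1) := fun k hk => by
    rw [← hu k] at hk
    exact pos_of_mul_pos_left hk (hA.le.trans (hd k))
  by_cases hex : ∃ k, 0 < α + u k
  · obtain ⟨k, hk⟩ := hex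
    refine ⟨k + 1, fun n hn => ?_⟩
    induction n, hn using Nat.le_induction with
    | base => exact step k hk
    | succ n _ ih => exact step n (by linarith)
  · push Not at hex
    exfalso
    obtain ⟨δ, hδ, hδ1, hδ2⟩ : ∃ δ > 0, δ ≤ α ∧ δ ≤ α - s * (1 - A) :=
      ⟨_, lt_min hα h, min_le_left _ _, min_le_right _ _⟩
    have inc : ∀ k, δ ≤ A * (u (k + 1) - u k) := fun k => by
      have h1 : u (k + 1) * d k ≤ u (k + 1) * A :=
        mul_le_mul_of_nonpos_left (hd k) (by linarith [hex (k + 1)])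
      rw [hu k] at h1
      rcases le_total A 1 with hA1 | hA1
      · nlinarith [mul_le_mul_of_nonneg_left (hs k) (sub_nonneg.2 hA1)]
      · nlinarith [hex k]
    have lin : ∀ k : ℕ, k * δ ≤ A * (u k - u 0) := fun k => by
      induction k with
      | zero => simp
      | succ k ih =>
        push_cast
        linarith [inc k]
    obtain ⟨k, hk⟩ := exists_nat_gt (A * (-u 0) / δ)
    rw [div_lt_iff₀ hδ] at hk
    nlinarith [lin k, hex k]

lemma exists_forall_add_nonpos_of_mul_eq_add {u d : ℕ → ℝ} {α A : ℝ} (hα : α < 0) (hA : 1 ≤ A)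
    (hu : ∀ k, u (k + 1) * d k = α + u k) (hd : ∀ k, A ≤ d k) :
    ∃ K, ∀ k ≥ K, α + u k ≤ 0 := by
  have dpos : ∀ k, 0 < d k := fun k => by linarith [hd k]
  by_cases hex : ∃ k, α + u k ≤ 0
  · obtain ⟨k, hk⟩ := hex
    refine ⟨k, fun n hn => ?_⟩
    induction n, hn using Nat.le_induction with
    | base => exact hk
    | succ n _ ih =>
      rw [← hu n] at ih
      linarith [nonpos_of_mul_nonpos_left ih (dpos n)]
  · push Not at hex
    exfalso
    have lin : ∀ k : ℕ, u k ≤ u 0 + k * α := fun k => by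
      induction k with
      | zero => simp
      | succ k ih =>
        have h1 : u (k + 1) * 1 ≤ u (k + 1) * d k :=
          mul_le_mul_of_nonneg_left (hA.trans (hd k)) (by linarith [hex (k + 1)])
        rw [hu k] at h1
        push_cast
        linarith
    obtain ⟨k, hk⟩ := exists_nat_gt (u 0 / -α)
    rw [div_lt_iff₀ (by linarith)] at hk
    linarith [lin k, hex k]

lemma tendsto_zero_of_mul_eq {u d : ℕ → ℝ} {A : ℝ} (hA : 1 < A)
    (hu : ∀ k, u (k + 1) * d k = u k) (hd : ∀ k, A ≤ d k) : Tendsto u atTop (𝓝 0) := by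
  have hA0 : 0 < A := by linarith
  have key : ∀ k, ‖u k‖ ≤ |u 0| * (A⁻¹) ^ k := fun k => by
    induction k with
    | zero => simp
    | succ k ih =>
      rw [Real.norm_eq_abs] at ih ⊢
      have h1 : |u (k + 1)| * A ≤ |u k| := by
        rw [← hu k, abs_mul]
        exact mul_le_mul_of_nonneg_left ((hd k).trans (le_abs_self _)) (abs_nonneg _)
      rw [pow_succ, ← mul_assoc, ← div_eq_mul_inv, le_div_iff₀ hA0]
      exact h1.trans ih
  refine squeeze_zero_norm key ?_
  simpa using (tendsto_pow_atTop_nhds_zero_of_lt_one (inv_nonneg.2 hA0.le)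
    (inv_lt_one_of_one_lt₀ hA)).const_mul |u 0|

lemma LimitRange.exists_rational_eq {y : ℕ → ℝ} {m M L α β γ A B C : ℝ} (h : LimitRange y m M)
    (hL : MapClusterPt L atTop y)
    (hrec : ∀ n, y (n + 2) * (A + B * y (n + 1) + C * y n) = α + β * y (n + 1) + γ * y n) :
    ∃ p ∈ Icc m M, ∃ q ∈ Icc m M, L * (A + B * p + C * q) = α + β * p + γ * q := by
  obtain ⟨σ, p, q, -, hp, hq, h2, h1, h0⟩ := h.exists_lagged hL
  refine ⟨p, hp, q, hq, tendsto_nhds_unique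
    (h2.mul (((h1.const_mul B).const_add A).add (h0.const_mul C))) ?_⟩
  simp only [hrec]
  exact ((h1.const_mul β).const_add α).add (h0.const_mul γ)

lemma exists_bound_of_rational {y : ℕ → ℝ} {α β γ A B C : ℝ} (hα : 0 ≤ α) (hβ : 0 ≤ β) (hγ : 0 ≤ γ)
    (hA : 0 < A) (hB : 0 < B) (hC : 0 < C) (hy : ∀ n, 0 ≤ y n)
    (hrec : ∀ n, y (n + 2) * (A + B * y (n + 1) + C * y n) = α + β * y (n + 1) + γ * y n) :
    ∃ b, ∀ n, y n ≤ b := by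
  have hK : 0 ≤ α / A + β / B + γ / C := by positivity
  refine ⟨y 0 + y 1 + (α / A + β / B + γ / C), fun n => ?_⟩
  match n with
  | 0 => linarith [hy 1]
  | 1 => linarith [hy 0]
  | n + 2 =>
    have h0 := hy n
    have h1 := hy (n + 1)
    suffices y (n + 2) ≤ α / A + β / B + γ / C by linarith [hy 0, hy 1]
    have hden : 0 < A + B * y (n + 1) + C * y n := by positivity
    refine le_of_mul_le_mul_right ?_ hden
    rw [hrec n]
    have e : (α / A + β / B + γ / C) * (A + B * y (n + 1) + C * y n) =
        α + β * y (n + 1) + γ * y n +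
        (α / A * (B * y (n + 1) + C * y n) + β / B * (A + C * y n) +
          γ / C * (A + B * y (n + 1))) := by
      field_simp
      ring
    rw [e]
    have : 0 ≤ α / A * (B * y (n + 1) + C * y n) + β / B * (A + C * y n) +
        γ / C * (A + B * y (n + 1)) := by positivity
    linarith

/-- The recursion `y (n + 2) = (α + y n) / (A + b * y (n + 1) + y n)` with positive terms. -/
lemma ParityConvergent.of_pos_of_numerator_lag_two {y : ℕ → ℝ} {α A b : ℝ} (hα : 0 < α)
    (hA : 0 < A) (hb : 0 < b) (hy : ∀ n, 0 < y n)
    (hrec : ∀ n, y (n + 2) * (A + b * y (n + 1) + y n) = α + y n) : ParityConvergent y := by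
  have hrec' : ∀ n, y (n + 2) * (A + b * y (n + 1) + 1 * y n) = α + 0 * y (n + 1) + 1 * y n :=
    fun n => by linarith [hrec n]
  obtain ⟨b', hb'⟩ := exists_bound_of_rational hα.le le_rfl zero_le_one hA hb one_pos
    (fun n => (hy n).le) hrec'
  obtain ⟨m, M, h⟩ := exists_limitRange (fun n => (hy n).le) hb'
  have hm : 0 ≤ m := h.ge_of_forall fun n => (hy n).le
  rcases h.le.eq_or_lt with he | hlt
  · exact .of_tendsto (h.tendsto he)
  obtain ⟨p, hp, q, hq, eM⟩ := h.exists_rational_eq h.cluster_upper hrec'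
  obtain ⟨p', hp', q', hq', em⟩ := h.exists_rational_eq h.cluster_lower hrec'
  have iM : M * (A + b * m) - α ≤ q * (1 - M) := by
    have := mul_le_mul_of_nonneg_left (mul_le_mul_of_nonneg_left hp.1 hb.le) (hm.trans h.le)
    linarith
  have im : q' * (1 - m) ≤ m * (A + b * M) - α := by
    have := mul_le_mul_of_nonneg_left (mul_le_mul_of_nonneg_left hp'.2 hb.le) hm
    linarith
  have hM1 : M ≤ 1 := by
    by_contra! hM1
    have h1 := mul_le_mul_of_nonpos_right hq.1 (sub_nonpos.2 hM1.le)
    rcases le_total 1 m with hm1 | hm1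
    · have h2 := mul_le_mul_of_nonpos_right hq'.2 (sub_nonpos.2 hm1)
      nlinarith
    · have h2 := mul_le_mul_of_nonneg_right hq'.1 (sub_nonneg.2 hm1)
      nlinarith
  have hkey : α < A + b * m := by
    have h2 := mul_le_mul_of_nonneg_right hq'.1 (sub_nonneg.2 (hlt.le.trans hM1))
    have h3 : 0 < (1 - m) * (A + m) := mul_pos (by linarith) (by linarith)
    have h4 : b * m * M ≤ b * m := mul_le_of_le_one_right (by positivity) hM1
    linarith
  obtain ⟨N, hN⟩ := eventually_atTop.1
    (h.eventually_mem ((A + b * m - α) / b) (div_pos (by linarith) hb))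
  have hz : ∀ n ≥ N, α < A + b * y n := fun n hn => by
    have h1 := (hN n hn).1
    rw [sub_lt_iff_lt_add, ← sub_lt_iff_lt_add', lt_div_iff₀ hb] at h1
    linarith
  have hlt1 : ∀ n ≥ N, y (n + 2) < 1 := fun n hn => by
    have h1 := hz (n + 1) (by omega)
    have h2 := hy n
    have h3 := hrec n
    by_contra! h4
    nlinarith [mul_nonneg (sub_nonneg.2 h4) (by linarith : 0 ≤ A + b * y (n + 1) + y n)]
  have key : ∀ n, (y (n + 4) - y (n + 2)) * (A + b * y (n + 3) + y (n + 2)) =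
      (y (n + 2) - y n) * (1 - y (n + 2)) + b * y (n + 2) * (y (n + 1) - y (n + 3)) := fun n => by
    linear_combination hrec (n + 2) - hrec n
  have dpos : ∀ n, 0 < A + b * y (n + 3) + y (n + 2) := fun n => by
    have := hy (n + 3)
    have := hy (n + 2)
    positivity
  refine .of_add N (.of_decreasing_increasing (fun n => (hy _).le) (fun n => hb' _)
    (fun n h1 h2 => ?_) fun n h1 h2 => ?_)
  · rw [show n + 2 + N = n + N + 2 by ring] at h1 ⊢
    rw [show n + 3 + N = n + N + 3 by ring, show n + 1 + N = n + N + 1 by ring] at h2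
    rw [show n + 4 + N = n + N + 4 by ring]
    refine sub_nonneg.1 (nonneg_of_mul_nonneg_left ?_ (dpos (n + N)))
    rw [key]
    exact add_nonneg (mul_nonneg (sub_nonneg.2 h1) (by linarith [hlt1 (n + N) (by omega)]))
      (mul_nonneg (mul_pos hb (hy _)).le (sub_nonneg.2 h2))
  · rw [show n + 2 + N = n + N + 2 by ring] at h1 ⊢
    rw [show n + 3 + N = n + N + 3 by ring, show n + 1 + N = n + N + 1 by ring] at h2
    rw [show n + 4 + N = n + N + 4 by ring]
    refine sub_nonpos.1 (nonpos_of_mul_nonpos_left ?_ (dpos (n + N)))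
    rw [key]
    exact add_nonpos (mul_nonpos_of_nonpos_of_nonneg (sub_nonpos.2 h1)
      (by linarith [hlt1 (n + N) (by omega)]))
      (mul_nonpos_of_nonneg_of_nonpos (mul_pos hb (hy _)).le (sub_nonpos.2 h2))

/-- A Lyapunov function for `y (n + 2) = (α + y (n + 1)) / (A + y (n + 1) + c * y n)` evaluated at
two consecutive terms, where `ω = (α - A) / c`. -/
noncomputable def lyapunov (c A ω u z : ℝ) : ℝ :=
  ((2 * c - 1) * (u ^ 2 + z ^ 2) + 2 * c * (2 * c - 1) * u * z + 2 * (c * A + 1) * (u + z) +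
    (A * (A + 2) + (2 * c - 1) * ω)) / ((2 * u - u ^ 2 - ω) * (2 * z - z ^ 2 - ω))

lemma lyapunov_sub {c A ω w z g : ℝ} (hw : 2 * w - w ^ 2 - ω ≠ 0) (hz : 2 * z - z ^ 2 - ω ≠ 0)
    (hg : 2 * g - g ^ 2 - ω ≠ 0) (h : c * (g * w - ω) = (1 - g) * (z + A)) :
    (lyapunov c A ω w z - lyapunov c A ω z g) *
      ((2 * w - w ^ 2 - ω) * (2 * z - z ^ 2 - ω) * (2 * g - g ^ 2 - ω)) =
    ((2 * c - 1) * z + A + 2) * (z + A) * (g - w) ^ 2 := by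
  have e1 : lyapunov c A ω w z *
      ((2 * w - w ^ 2 - ω) * (2 * z - z ^ 2 - ω)) =
      (2 * c - 1) * (w ^ 2 + z ^ 2) + 2 * c * (2 * c - 1) * w * z + 2 * (c * A + 1) * (w + z) +
        (A * (A + 2) + (2 * c - 1) * ω) := div_mul_cancel₀ _ (mul_ne_zero hw hz)
  have e2 : lyapunov c A ω z g *
      ((2 * z - z ^ 2 - ω) * (2 * g - g ^ 2 - ω)) =
      (2 * c - 1) * (z ^ 2 + g ^ 2) + 2 * c * (2 * c - 1) * z * g + 2 * (c * A + 1) * (z + g) +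
        (A * (A + 2) + (2 * c - 1) * ω) := div_mul_cancel₀ _ (mul_ne_zero hz hg)
  refine mul_right_cancel₀ hz ?_
  linear_combination (2 * z - z ^ 2 - ω) * ((2 * g - g ^ 2 - ω) * e1 - (2 * w - w ^ 2 - ω) * e2) +
    (2 * z - z ^ 2 - ω) * (2 * ((2 * c - 1) * z + A + 2) * (w - g)) * h

lemma lyapunov_nonneg {c A ω u z : ℝ} (hc : 1 < c) (hA : 0 < A) (hω : 0 < A + c * ω)
    (hu : 0 ≤ u) (hz : 0 ≤ z) (hqu : 0 < 2 * u - u ^ 2 - ω) (hqz : 0 < 2 * z - z ^ 2 - ω) :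
    0 ≤ lyapunov c A ω u z := by
  have hd : 0 ≤ 2 * c - 1 := by linarith
  have h1 : 0 ≤ A * (A + 2) + (2 * c - 1) * ω := by
    refine nonneg_of_mul_nonneg_right (a := c) ?_ (by linarith)
    nlinarith [mul_pos hA hA, mul_pos (by linarith : (0:ℝ) < c) (mul_pos hA hA),
      mul_pos (by linarith : 0 < 2 * c - 1) hω]
  unfold lyapunov
  positivity

lemma tendsto_sub_of_antitone {V : ℕ → ℝ} {N : ℕ} (h0 : ∀ n ≥ N, 0 ≤ V n)
    (h : ∀ n ≥ N, V (n + 1) ≤ V n) : Tendsto (fun n => V n - V (n + 1)) atTop (𝓝 0) := by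
  have : ∃ l, Tendsto (fun n => V (n + N)) atTop (𝓝 l) :=
    ⟨_, tendsto_atTop_ciInf (antitone_nat_of_succ_le fun n => by
      rw [show n + 1 + N = n + N + 1 by ring]
      exact h _ (by omega)) ⟨0, by rintro _ ⟨n, rfl⟩; exact h0 _ (by omega)⟩⟩
  obtain ⟨l, hl⟩ := this
  have hl := (tendsto_add_atTop_iff_nat N).1 hl
  simpa using hl.sub ((tendsto_add_atTop_iff_nat 1).2 hl)

/-- Solutions of the recursion on which the Lyapunov function is defined have vanishing
two-step increments. -/
lemma tendsto_two_step_sub {y : ℕ → ℝ} {α A c ω : ℝ} {N : ℕ} (hα : 0 < α) (hA : 0 < A)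
    (hc : 1 < c) (hω : c * ω = α - A) (hy : ∀ n, 0 < y n)
    (hrec : ∀ n, y (n + 2) * (A + y (n + 1) + c * y n) = α + y (n + 1))
    (hq : ∀ n ≥ N, 0 < 2 * y n - y n ^ 2 - ω) :
    Tendsto (fun n => y (n + 2) - y n) atTop (𝓝 0) := by
  have q_le : ∀ n, 2 * y n - y n ^ 2 - ω ≤ 1 - ω := fun n => by nlinarith [sq_nonneg (y n - 1)]
  have hω1 : 0 < 1 - ω := (hq N le_rfl).trans_le (q_le N)
  have hsub : ∀ n ≥ N, 2 * A * (y (n + 2) - y n) ^ 2 ≤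
      (lyapunov c A ω (y n) (y (n + 1)) - lyapunov c A ω (y (n + 1)) (y (n + 2))) *
      ((2 * y n - y n ^ 2 - ω) * (2 * y (n + 1) - y (n + 1) ^ 2 - ω) *
        (2 * y (n + 2) - y (n + 2) ^ 2 - ω)) := fun n hn => by
    rw [lyapunov_sub (hq n hn).ne' (hq (n + 1) (by omega)).ne' (hq (n + 2) (by omega)).ne'
      (by linear_combination hrec n - hω)]
    refine mul_le_mul_of_nonneg_right (mul_le_mul ?_ ?_ hA.le ?_) (sq_nonneg _)
    · nlinarith [hy (n + 1)]
    · linarith [hy (n + 1)]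
    · nlinarith [hy (n + 1)]
  have qpos : ∀ n ≥ N, 0 < (2 * y n - y n ^ 2 - ω) * (2 * y (n + 1) - y (n + 1) ^ 2 - ω) *
        (2 * y (n + 2) - y (n + 2) ^ 2 - ω) := fun n hn =>
    mul_pos (mul_pos (hq n hn) (hq _ (by omega))) (hq _ (by omega))
  have hdec : ∀ n ≥ N, lyapunov c A ω (y (n + 1)) (y (n + 2)) ≤
      lyapunov c A ω (y n) (y (n + 1)) := fun n hn =>
    sub_nonneg.1 (nonneg_of_mul_nonneg_left ((by positivity : (0:ℝ) ≤ _).trans (hsub n hn))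
      (qpos n hn))
  have hV := tendsto_sub_of_antitone (V := fun n => lyapunov c A ω (y n) (y (n + 1))) (N := N)
    (fun n hn => lyapunov_nonneg hc hA (by linarith) (hy _).le (hy _).le (hq _ hn)
      (hq _ (by omega))) hdec
  have hsq : Tendsto (fun n => (y (n + 2) - y n) ^ 2) atTop (𝓝 0) := by
    have hV' := hV.mul_const ((1 - ω) ^ 3 / (2 * A))
    rw [zero_mul] at hV'
    refine squeeze_zero' (.of_forall fun n => sq_nonneg _) ?_ hV'
    filter_upwards [eventually_ge_atTop N] with n hn
    rw [← mul_div_assoc, le_div_iff₀ (by positivity), mul_comm]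
    refine (hsub n hn).trans (mul_le_mul_of_nonneg_left ?_ (sub_nonneg.2 (hdec n hn)))
    rw [show (1 - ω) ^ 3 = (1 - ω) * (1 - ω) * (1 - ω) by ring]
    exact mul_le_mul (mul_le_mul (q_le _) (q_le _) (hq _ (by omega)).le hω1.le) (q_le _)
      (hq _ (by omega)).le (by positivity)
  rw [tendsto_zero_iff_abs_tendsto_zero]
  simpa [Function.comp_def, Real.sqrt_sq_eq_abs] using (Real.continuous_sqrt.tendsto 0).comp hsq

/-- The recursion `y (n + 2) = (α + y (n + 1)) / (A + y (n + 1) + c * y n)` with positive terms. -/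
lemma ParityConvergent.of_pos_of_numerator_lag_one {y : ℕ → ℝ} {α A c : ℝ} (hα : 0 < α)
    (hA : 0 < A) (hc : 0 < c) (hy : ∀ n, 0 < y n)
    (hrec : ∀ n, y (n + 2) * (A + y (n + 1) + c * y n) = α + y (n + 1)) :
    ParityConvergent y := by
  have hrec' : ∀ n, y (n + 2) * (A + 1 * y (n + 1) + c * y n) = α + 1 * y (n + 1) + 0 * y n :=
    fun n => by linarith [hrec n]
  obtain ⟨b', hb'⟩ := exists_bound_of_rational hα.le zero_le_one le_rfl hA one_pos hc
    (fun n => (hy n).le) hrec'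
  obtain ⟨m, M, h⟩ := exists_limitRange (fun n => (hy n).le) hb'
  have hm : 0 ≤ m := h.ge_of_forall fun n => (hy n).le
  rcases h.le.eq_or_lt with he | hlt
  · exact .of_tendsto (h.tendsto he)
  obtain ⟨p, hp, q, hq, eM⟩ := h.exists_rational_eq h.cluster_upper hrec'
  obtain ⟨p', hp', q', hq', em⟩ := h.exists_rational_eq h.cluster_lower hrec'
  have iM : M * (A + c * m) - α ≤ p * (1 - M) := by
    have := mul_le_mul_of_nonneg_left (mul_le_mul_of_nonneg_left hq.1 hc.le) (hm.trans h.le)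
    linarith
  have im : p' * (1 - m) ≤ m * (A + c * M) - α := by
    have := mul_le_mul_of_nonneg_left (mul_le_mul_of_nonneg_left hq'.2 hc.le) hm
    linarith
  have hM1 : M ≤ 1 := by
    by_contra! hM1
    have h1 := mul_le_mul_of_nonpos_right hp.1 (sub_nonpos.2 hM1.le)
    rcases le_total 1 m with hm1 | hm1
    · have h2 := mul_le_mul_of_nonpos_right hp'.2 (sub_nonpos.2 hm1)
      nlinarith
    · have h2 := mul_le_mul_of_nonneg_right hp'.1 (sub_nonneg.2 hm1)
      nlinarith
  have jM := iM.trans (mul_le_mul_of_nonneg_right hp.2 (sub_nonneg.2 hM1))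
  have jm := (mul_le_mul_of_nonneg_right hp'.1 (sub_nonneg.2 (hlt.le.trans hM1))).trans im
  have hsum : A ≤ 1 - (M + m) := by
    refine le_of_mul_le_mul_left ?_ (sub_pos.2 hlt)
    linarith
  have hc1 : 1 < c := by
    by_contra! hc1
    nlinarith [mul_nonneg (sub_nonneg.2 hc1) (mul_nonneg hm (hm.trans h.le)),
      mul_le_mul_of_nonneg_left hsum hm]
  have hω : c * ((α - A) / c) = α - A := by field_simp
  set ω := (α - A) / c
  have hlow : c * ω < c * (M * m) := by
    rw [hω]
    nlinarith [mul_pos (by linarith : 0 < 1 - m) (by linarith : 0 < A + m)]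
  have hlow : ω < M * m := lt_of_mul_lt_mul_left hlow hc.le
  have hqm : 0 < 2 * m - m ^ 2 - ω := by
    nlinarith [mul_nonneg hm (by linarith : 0 ≤ 2 - m - M)]
  have hqM : 0 < 2 * M - M ^ 2 - ω := by
    nlinarith [mul_nonneg (hm.trans h.le) (by linarith : 0 ≤ 2 - m - M)]
  obtain ⟨ε, hε, h1, h2⟩ : ∃ ε > 0, 0 < 2 * (m - ε) - (m - ε) ^ 2 - ω ∧
      0 < 2 * (M + ε) - (M + ε) ^ 2 - ω := by
    have c1 : ∀ᶠ ε in 𝓝 (0:ℝ), 0 < 2 * (m - ε) - (m - ε) ^ 2 - ω :=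
      (by fun_prop : Continuous fun ε : ℝ => 2 * (m - ε) - (m - ε) ^ 2 - ω).continuousAt.eventually
        (lt_mem_nhds (by simpa using hqm))
    have c2 : ∀ᶠ ε in 𝓝 (0:ℝ), 0 < 2 * (M + ε) - (M + ε) ^ 2 - ω :=
      (by fun_prop : Continuous fun ε : ℝ => 2 * (M + ε) - (M + ε) ^ 2 - ω).continuousAt.eventually
        (lt_mem_nhds (by simpa using hqM))
    obtain ⟨ε, ⟨h1, h2⟩, hε⟩ := (((c1.and c2).filter_mono nhdsWithin_le_nhds).and
      (self_mem_nhdsWithin (s := Ioi (0:ℝ)))).exists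
    exact ⟨ε, hε, h1, h2⟩
  obtain ⟨N, hN⟩ := eventually_atTop.1 (h.eventually_mem ε hε)
  have hqy : ∀ n ≥ N, 0 < 2 * y n - y n ^ 2 - ω := fun n hn => by
    obtain ⟨h3, h4⟩ := hN n hn
    refine pos_of_mul_pos_right (a := M + ε - (m - ε)) ?_ (by linarith)
    have e : (M + ε - (m - ε)) * (2 * y n - y n ^ 2 - ω) =
        (M + ε - y n) * (2 * (m - ε) - (m - ε) ^ 2 - ω) +
        (y n - (m - ε)) * (2 * (M + ε) - (M + ε) ^ 2 - ω) +
        (M + ε - (m - ε)) * (y n - (m - ε)) * (M + ε - y n) := by ring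
    have p1 : 0 < M + ε - y n := by linarith
    have p2 : 0 < y n - (m - ε) := by linarith
    have p3 : 0 < M + ε - (m - ε) := by linarith
    rw [e]
    positivity
  have hstep := tendsto_two_step_sub hα hA hc1 hω hy hrec hqy
  have fix : ∀ L, MapClusterPt L atTop y → 0 ≤ L → L * (A + L + c * L) = α + L := by
    intro L hL hL0
    obtain ⟨σ, p, q, hσ, hp, -, h2, h1, h0⟩ := h.exists_lagged hL
    have hq : q = L := by
      have := h0.add (hstep.comp hσ)
      simp only [Function.comp_def, add_sub_cancel, add_zero] at this
      exact tendsto_nhds_unique this h2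
    subst hq
    have h3 : Tendsto (fun k => y (σ k + 3)) atTop (𝓝 p) := by
      have := h1.add (hstep.comp ((tendsto_add_atTop_nat 1).comp hσ))
      simpa only [Function.comp_def, add_sub_cancel, add_zero] using this
    have e1 : q * (A + p + c * q) = α + p := by
      refine tendsto_nhds_unique (h2.mul ((h1.const_add A).add (h0.const_mul c))) ?_
      simp only [hrec]
      exact h1.const_add α
    have e2 : p * (A + q + c * p) = α + q := by
      refine tendsto_nhds_unique (h3.mul ((h2.const_add A).add (h1.const_mul c))) ?_
      simp only [fun k => hrec (σ k + 1)]
      exact h2.const_add α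
    have e3 : (q - p) * (A + c * (q + p) + 1) = 0 := by linear_combination e1 - e2
    have hp0 : 0 ≤ p := hm.trans hp.1
    have hqp : q - p = 0 := (mul_eq_zero.1 e3).resolve_right (by positivity)
    rwa [show p = q by linarith] at e1
  have fM := fix M h.cluster_upper (hm.trans h.le)
  have fm := fix m h.cluster_lower hm
  have e : (M - m) * ((1 + c) * (M * m) + α) = 0 := by linear_combination m * fM - M * fm
  have hM0 : 0 ≤ M := hm.trans h.le
  have := (mul_eq_zero.1 e).resolve_right (by positivity)
  linarith

lemma one_lt_of_mul_one_sub_lt {s A α : ℝ} (hs : 0 ≤ s) (h : 0 < α - s * (1 - A)) (hα : α ≤ 0) :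
    1 < A := by
  by_contra! hA
  linarith [mul_nonneg hs (sub_nonneg.2 hA)]

lemma ParityConvergent.of_numerator_lag_one {y : ℕ → ℝ} {α A c s b : ℝ} (hA : 0 < A) (hc : 0 < c)
    (hs : 0 ≤ s) (h : 0 < α - s * (1 - A)) (hy : ∀ n, -s ≤ y n) (hb : ∀ n, y n ≤ b)
    (hrec : ∀ n, y (n + 2) * (A + (y (n + 1) + s) + c * (y n + s)) = α + y (n + 1)) :
    ParityConvergent y := by
  have hd : ∀ n, A ≤ A + (y (n + 1) + s) + c * (y n + s) := fun n => by
    have h1 : 0 ≤ y (n + 1) + s := by linarith [hy (n + 1)]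
    have h2 : 0 ≤ y n + s := by linarith [hy n]
    linarith [mul_nonneg hc.le h2]
  rcases lt_trichotomy α 0 with hα | hα | hα
  · obtain ⟨K, hK⟩ := exists_forall_add_nonpos_of_mul_eq_add (u := fun k => y (k + 1)) hα
      (one_lt_of_mul_one_sub_lt hs h hα.le).le hrec hd
    have hneg : ∀ n ≥ K, y (n + 2) ≤ 0 := fun n hn =>
      nonpos_of_mul_nonpos_left ((hrec n).trans_le (hK n hn)) (hA.trans_le (hd n))
    have key : ∀ n, (y (n + 4) - y (n + 2)) * (A + (y (n + 3) + s) + c * (y (n + 2) + s)) =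
        (y (n + 3) - y (n + 1)) * (1 - y (n + 2)) + c * -y (n + 2) * (y (n + 2) - y n) :=
      fun n => by linear_combination hrec (n + 2) - hrec n
    refine .of_add K (.of_increasing (fun n => hy _) (fun n => hb _)
      (fun n h1 h2 => ?_) fun n h1 h2 => ?_)
    · have hn := hneg (n + K) (by omega)
      have hkey := key (n + K)
      rw [show n + 2 + K = n + K + 2 by ring] at h1 ⊢
      rw [show n + 3 + K = n + K + 3 by ring, show n + 1 + K = n + K + 1 by ring] at h2
      rw [show n + 4 + K = n + K + 4 by ring]
      refine sub_nonneg.1 (nonneg_of_mul_nonneg_left ?_ (hA.trans_le (hd (n + K + 2))))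
      rw [hkey]
      exact add_nonneg (mul_nonneg (sub_nonneg.2 h2) (by linarith))
        (mul_nonneg (mul_nonneg hc.le (neg_nonneg.2 hn)) (sub_nonneg.2 h1))
    · have hn := hneg (n + K) (by omega)
      have hkey := key (n + K)
      rw [show n + 2 + K = n + K + 2 by ring] at h1 ⊢
      rw [show n + 3 + K = n + K + 3 by ring, show n + 1 + K = n + K + 1 by ring] at h2
      rw [show n + 4 + K = n + K + 4 by ring]
      refine sub_nonpos.1 (nonpos_of_mul_nonpos_left ?_ (hA.trans_le (hd (n + K + 2))))
      rw [hkey]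
      exact add_nonpos (mul_nonpos_of_nonpos_of_nonneg (sub_nonpos.2 h2) (by linarith))
        (mul_nonpos_of_nonneg_of_nonpos (mul_nonneg hc.le (neg_nonneg.2 hn)) (sub_nonpos.2 h1))
  · subst hα
    exact .of_succ (.of_tendsto (tendsto_zero_of_mul_eq (u := fun k => y (k + 1))
      (one_lt_of_mul_one_sub_lt hs h le_rfl) (fun n => by simpa using hrec n) hd))
  · obtain ⟨K, hK⟩ := exists_forall_pos_of_mul_eq_add (u := fun k => y (k + 1)) hα hA hrec hd
      (fun k => hy _) h
    refine .of_add (K + 1) (.of_pos_of_numerator_lag_one (A := A + s + c * s) hα (by positivity) hc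
      (fun n => hK (n + K) (by omega)) fun n => ?_)
    have := hrec (n + (K + 1))
    rw [show n + 2 + (K + 1) = n + (K + 1) + 2 by ring,
      show n + 1 + (K + 1) = n + (K + 1) + 1 by ring]
    linarith

lemma exists_forall_of_parity {P : ℕ → Prop} (h : ∀ i, ∃ K, ∀ k ≥ K, P (2 * k + i)) :
    ∃ N, ∀ n ≥ N, P n := by
  obtain ⟨K₀, h0⟩ := h 0
  obtain ⟨K₁, h1⟩ := h 1
  refine ⟨2 * (K₀ + K₁), fun n hn => ?_⟩
  rcases n.even_or_odd' with ⟨k, rfl | rfl⟩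
  · exact h0 k (by omega)
  · exact h1 k (by omega)

lemma ParityConvergent.of_numerator_lag_two {y : ℕ → ℝ} {α A b s b' : ℝ} (hA : 0 < A) (hb : 0 < b)
    (hs : 0 ≤ s) (h : 0 < α - s * (1 - A)) (hy : ∀ n, -s ≤ y n) (hb' : ∀ n, y n ≤ b')
    (hrec : ∀ n, y (n + 2) * (A + b * (y (n + 1) + s) + (y n + s)) = α + y n) :
    ParityConvergent y := by
  have hd : ∀ n, A ≤ A + b * (y (n + 1) + s) + (y n + s) := fun n => by
    have h1 : 0 ≤ y (n + 1) + s := by linarith [hy (n + 1)]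
    have h2 : 0 ≤ y n + s := by linarith [hy n]
    linarith [mul_nonneg hb.le h1]
  have hrec_par : ∀ i k, y (2 * (k + 1) + i) *
      (A + b * (y (2 * k + i + 1) + s) + (y (2 * k + i) + s)) = α + y (2 * k + i) := fun i k => by
    rw [show 2 * (k + 1) + i = 2 * k + i + 2 by ring]
    exact hrec _
  rcases lt_trichotomy α 0 with hα | hα | hα
  · obtain ⟨K, hK⟩ := exists_forall_of_parity (P := fun n => α + y n ≤ 0) fun i =>
      exists_forall_add_nonpos_of_mul_eq_add (u := fun k => y (2 * k + i)) hα
        (one_lt_of_mul_one_sub_lt hs h hα.le).le (hrec_par i) fun k => hd _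
    have hneg : ∀ n ≥ K, y (n + 2) ≤ 0 := fun n hn =>
      nonpos_of_mul_nonpos_left ((hrec n).trans_le (hK n hn)) (hA.trans_le (hd n))
    have key : ∀ n, (y (n + 4) - y (n + 2)) * (A + b * (y (n + 3) + s) + (y (n + 2) + s)) =
        (y (n + 2) - y n) * (1 - y (n + 2)) + b * -y (n + 2) * (y (n + 3) - y (n + 1)) :=
      fun n => by linear_combination hrec (n + 2) - hrec n
    refine .of_add K (.of_increasing (fun n => hy _) (fun n => hb' _)
      (fun n h1 h2 => ?_) fun n h1 h2 => ?_)
    · have hn := hneg (n + K) (by omega)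
      have hkey := key (n + K)
      rw [show n + 2 + K = n + K + 2 by ring] at h1 ⊢
      rw [show n + 3 + K = n + K + 3 by ring, show n + 1 + K = n + K + 1 by ring] at h2
      rw [show n + 4 + K = n + K + 4 by ring]
      refine sub_nonneg.1 (nonneg_of_mul_nonneg_left ?_ (hA.trans_le (hd (n + K + 2))))
      rw [hkey]
      exact add_nonneg (mul_nonneg (sub_nonneg.2 h1) (by linarith))
        (mul_nonneg (mul_nonneg hb.le (neg_nonneg.2 hn)) (sub_nonneg.2 h2))
    · have hn := hneg (n + K) (by omega)
      have hkey := key (n + K)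
      rw [show n + 2 + K = n + K + 2 by ring] at h1 ⊢
      rw [show n + 3 + K = n + K + 3 by ring, show n + 1 + K = n + K + 1 by ring] at h2
      rw [show n + 4 + K = n + K + 4 by ring]
      refine sub_nonpos.1 (nonpos_of_mul_nonpos_left ?_ (hA.trans_le (hd (n + K + 2))))
      rw [hkey]
      exact add_nonpos (mul_nonpos_of_nonpos_of_nonneg (sub_nonpos.2 h1) (by linarith))
        (mul_nonpos_of_nonneg_of_nonpos (mul_nonneg hb.le (neg_nonneg.2 hn)) (sub_nonpos.2 h2))
  · subst hα
    have hlim : ∀ i, Tendsto (fun k => y (2 * k + i)) atTop (𝓝 0) := fun i =>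
      tendsto_zero_of_mul_eq (u := fun k => y (2 * k + i)) (one_lt_of_mul_one_sub_lt hs h le_rfl)
        (fun k => by simpa using hrec_par i k) fun k => hd _
    exact ⟨0, 0, hlim 0, hlim 1⟩
  · obtain ⟨K, hK⟩ := exists_forall_of_parity (P := fun n => 0 < y n) fun i =>
      exists_forall_pos_of_mul_eq_add (u := fun k => y (2 * k + i)) hα hA (hrec_par i)
        (fun k => hd _) (fun k => hy _) h
    refine .of_add K (.of_pos_of_numerator_lag_two (A := A + b * s + s) hα (by positivity) hb
      (fun n => hK (n + K) (by omega)) fun n => ?_)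
    have := hrec (n + K)
    rw [show n + 2 + K = n + K + 2 by ring, show n + 1 + K = n + K + 1 by ring]
    linarith

lemma ParityConvergent.of_affine {x : ℕ → ℝ} {s t : ℝ} (ht : t ≠ 0)
    (h : ParityConvergent fun n => (x n - s) / t) : ParityConvergent x := by
  have e : x = fun n => s + t * ((x n - s) / t) := by
    funext n
    field_simp
    ring
  rw [e]
  exact h.affine s t

/-- The case in which the numerator and the denominator are proportional up to a constant. -/
lemma ParityConvergent.of_proportional {x : ℕ → ℝ} {α A B C s b : ℝ} (hA : 0 < A) (hB : 0 < B)
    (hC : 0 < C) (hs : 0 ≤ s) (hx : ∀ n, 0 ≤ x n) (hb : ∀ n, x n ≤ b)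
    (hrec : ∀ n, x (n + 2) * (A + B * x (n + 1) + C * x n) =
      α + s * B * x (n + 1) + s * C * x n) : ParityConvergent x := by
  have hden : ∀ n, 0 < A + B * x (n + 1) + C * x n := fun n => by
    have := hx n
    have := hx (n + 1)
    positivity
  have hrec' : ∀ n, (x (n + 2) - s) * (A + B * x (n + 1) + C * x n) = α - s * A := fun n => by
    linear_combination hrec n
  rcases le_total (α - s * A) 0 with he | he
  · have hle : ∀ n, x (n + 2) - s ≤ 0 := fun n =>
      nonpos_of_mul_nonpos_left ((hrec' n).trans_le he) (hden n)
    have key : ∀ n, (x (n + 4) - x (n + 2)) * (A + B * x (n + 3) + C * x (n + 2)) =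
        (s - x (n + 2)) * (B * (x (n + 3) - x (n + 1)) + C * (x (n + 2) - x n)) := fun n => by
      linear_combination hrec' (n + 2) - hrec' n
    refine .of_increasing hx hb (fun n h1 h2 => ?_) fun n h1 h2 => ?_
    · refine sub_nonneg.1 (nonneg_of_mul_nonneg_left ?_ (hden (n + 2)))
      rw [key]
      exact mul_nonneg (by linarith [hle n])
        (add_nonneg (mul_nonneg hB.le (sub_nonneg.2 h2)) (mul_nonneg hC.le (sub_nonneg.2 h1)))
    · refine sub_nonpos.1 (nonpos_of_mul_nonpos_left ?_ (hden (n + 2)))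
      rw [key]
      exact mul_nonpos_of_nonneg_of_nonpos (by linarith [hle n])
        (add_nonpos (mul_nonpos_of_nonneg_of_nonpos hB.le (sub_nonpos.2 h2))
          (mul_nonpos_of_nonneg_of_nonpos hC.le (sub_nonpos.2 h1)))
  · obtain ⟨m, M, h⟩ := exists_limitRange hx hb
    have hm : 0 ≤ m := h.ge_of_forall hx
    have aux : ∀ L p q, p ∈ Icc m M → q ∈ Icc m M →
        L * (A + B * p + C * q) = α + s * B * p + s * C * q →
        (L - s) * (A + (B + C) * m) ≤ α - s * A ∧ α - s * A ≤ (L - s) * (A + (B + C) * M) := by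
      intro L p q hp hq e
      have e' : (L - s) * (A + B * p + C * q) = α - s * A := by linear_combination e
      have hp0 : 0 ≤ p := hm.trans hp.1
      have hq0 : 0 ≤ q := hm.trans hq.1
      have hL : 0 ≤ L - s := nonneg_of_mul_nonneg_left (e' ▸ he) (by positivity)
      rw [← e']
      constructor <;> refine mul_le_mul_of_nonneg_left ?_ hL
      · linarith [mul_le_mul_of_nonneg_left hp.1 hB.le, mul_le_mul_of_nonneg_left hq.1 hC.le]
      · linarith [mul_le_mul_of_nonneg_left hp.2 hB.le, mul_le_mul_of_nonneg_left hq.2 hC.le]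
    obtain ⟨p, hp, q, hq, eM⟩ := h.exists_rational_eq h.cluster_upper hrec
    obtain ⟨p', hp', q', hq', em⟩ := h.exists_rational_eq h.cluster_lower hrec
    have h1 := (aux M p q hp hq eM).1
    have h2 := (aux m p' q' hp' hq' em).2
    refine .of_tendsto (h.tendsto (h.le.antisymm (sub_nonpos.1 ?_)))
    refine nonpos_of_mul_nonpos_left (b := A + s * (B + C)) ?_ (by positivity)
    linarith

lemma ParityConvergent.of_rational {x : ℕ → ℝ} {α β γ A B C : ℝ} (hα : 0 < α) (hβ : 0 < β)
    (hγ : 0 < γ) (hA : 0 < A) (hB : 0 < B) (hC : 0 < C) (hx : ∀ n, 0 ≤ x n)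
    (hrec : ∀ n, x (n + 2) * (A + B * x (n + 1) + C * x n) = α + β * x (n + 1) + γ * x n) :
    ParityConvergent x := by
  obtain ⟨b, hb⟩ := exists_bound_of_rational hα.le hβ.le hγ.le hA hB hC hx hrec
  obtain ⟨r, hr, rfl⟩ : ∃ r, 0 < r ∧ β = r * B := ⟨β / B, by positivity, by field_simp⟩
  obtain ⟨s, hs, rfl⟩ : ∃ s, 0 < s ∧ γ = s * C := ⟨γ / C, by positivity, by field_simp⟩
  rcases lt_trichotomy s r with hlt | rfl | hlt
  · obtain ⟨t, ht, rfl⟩ : ∃ t, 0 < t ∧ r = s + t := ⟨r - s, by linarith, by ring⟩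
    refine .of_affine (s := s) ht.ne' (.of_numerator_lag_one (A := A / (B * t)) (c := C / B)
      (s := s / t) (α := (α - s * A + B * t * s) / (B * t ^ 2)) (b := (b - s) / t)
      (by positivity) (by positivity) (by positivity) ?_ (fun n => ?_) (fun n => ?_) fun n => ?_)
    · have : (α - s * A + B * t * s) / (B * t ^ 2) - s / t * (1 - A / (B * t)) =
          α / (B * t ^ 2) := by
        field_simp
        ring
      rw [this]
      positivity
    · rw [← neg_div]
      gcongr
      linarith [hx n]
    · gcongr
      exact hb n
    · field_simp
      linear_combination hrec n
  · exact .of_proportional hA hB hC hs.le hx hb hrec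
  · obtain ⟨t, ht, rfl⟩ : ∃ t, 0 < t ∧ s = r + t := ⟨s - r, by linarith, by ring⟩
    refine .of_affine (s := r) ht.ne' (.of_numerator_lag_two (A := A / (C * t)) (b := B / C)
      (s := r / t) (α := (α - r * A + C * t * r) / (C * t ^ 2)) (b' := (b - r) / t)
      (by positivity) (by positivity) (by positivity) ?_ (fun n => ?_) (fun n => ?_) fun n => ?_)
    · have : (α - r * A + C * t * r) / (C * t ^ 2) - r / t * (1 - A / (C * t)) =
          α / (C * t ^ 2) := by
        field_simp
        ring
      rw [this]
      positivity
    · rw [← neg_div]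
      gcongr
      linarith [hx n]
    · gcongr
      exact hb n
    · field_simp
      linear_combination hrec n

lemma tendsto_of_tendsto_even_odd {x : ℕ → ℝ} {l : ℝ}
    (h0 : Tendsto (fun n => x (2 * n)) atTop (𝓝 l))
    (h1 : Tendsto (fun n => x (2 * n + 1)) atTop (𝓝 l)) : Tendsto x atTop (𝓝 l) := by
  intro s hs
  obtain ⟨N, hN⟩ := exists_forall_of_parity (P := fun n => x n ∈ s)
    (fun i => by
      rcases i.even_or_odd' with ⟨j, rfl | rfl⟩
      · obtain ⟨K, hK⟩ := eventually_atTop.1 (h0 hs)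
        exact ⟨K, fun k hk => by simpa [mul_add] using hK (k + j) (by omega)⟩
      · obtain ⟨K, hK⟩ := eventually_atTop.1 (h1 hs)
        exact ⟨K, fun k hk => by simpa [mul_add, add_assoc] using hK (k + j) (by omega)⟩)
  exact mem_map.2 (mem_atTop_sets.2 ⟨N, hN⟩)

/-- Theorem 1 (Eq. (3-3)): every solution with nonnegative initial conditions
converges to the unique positive equilibrium or to a prime period-two solution.
Here `x 0` plays the role of `x_{-1}` and `x 1` the role of `x_0`. -/
theorem stmt_0 (α β γ A B C : ℝ)
    (hα : 0 < α) (hβ : 0 < β) (hγ : 0 < γ) (hA : 0 < A) (hB : 0 < B) (hC : 0 < C)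
    (x : ℕ → ℝ) (hx0 : 0 ≤ x 0) (hx1 : 0 ≤ x 1)
    (hrec : ∀ n : ℕ, x (n + 2) =
      (α + β * x (n + 1) + γ * x n) / (A + B * x (n + 1) + C * x n))
    (xbar : ℝ) (hxbar_pos : 0 < xbar)
    (hxbar_eq : (B + C) * xbar ^ 2 + (A - β - γ) * xbar - α = 0) :
    Tendsto x atTop (nhds xbar) ∨
      ∃ φ ψ : ℝ, φ ≠ ψ ∧ 0 ≤ φ ∧ 0 ≤ ψ ∧
        φ = (α + β * ψ + γ * φ) / (A + B * ψ + C * φ) ∧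
        ψ = (α + β * φ + γ * ψ) / (A + B * φ + C * ψ) ∧
        ((Tendsto (fun n => x (2 * n)) atTop (nhds φ) ∧
          Tendsto (fun n => x (2 * n + 1)) atTop (nhds ψ)) ∨
         (Tendsto (fun n => x (2 * n)) atTop (nhds ψ) ∧
          Tendsto (fun n => x (2 * n + 1)) atTop (nhds φ))) := by
  have hx : ∀ n, 0 ≤ x n := by
    have : ∀ n, 0 ≤ x n ∧ 0 ≤ x (n + 1) := fun n => by
      induction n with
      | zero => exact ⟨hx0, hx1⟩
      | succ n ih =>
        obtain ⟨h0, h1⟩ := ih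
        refine ⟨h1, ?_⟩
        rw [hrec n]
        positivity
    exact fun n => (this n).1
  have hden : ∀ u v : ℝ, 0 ≤ u → 0 ≤ v → 0 < A + B * u + C * v := fun u v hu hv => by positivity
  obtain ⟨φ, ψ, hφ, hψ⟩ := ParityConvergent.of_rational hα hβ hγ hA hB hC hx fun n => by
    rw [hrec n, div_mul_cancel₀ _ (hden _ _ (hx _) (hx _)).ne']
  have hφ0 : 0 ≤ φ := ge_of_tendsto' hφ fun n => hx _
  have hψ0 : 0 ≤ ψ := ge_of_tendsto' hψ fun n => hx _
  have eφ : φ = (α + β * ψ + γ * φ) / (A + B * ψ + C * φ) := by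
    refine tendsto_nhds_unique ((tendsto_add_atTop_iff_nat 1).2 hφ) ?_
    simp only [mul_add, mul_one, hrec]
    exact (((hψ.const_mul β).const_add α).add (hφ.const_mul γ)).div
      (((hψ.const_mul B).const_add A).add (hφ.const_mul C)) (hden _ _ hψ0 hφ0).ne'
  have eψ : ψ = (α + β * φ + γ * ψ) / (A + B * φ + C * ψ) := by
    have hφ' := (tendsto_add_atTop_iff_nat 1).2 hφ
    refine tendsto_nhds_unique ((tendsto_add_atTop_iff_nat 1).2 hψ) ?_
    have e : ∀ n, x (2 * (n + 1) + 1) = (α + β * x (2 * (n + 1)) + γ * x (2 * n + 1)) /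
        (A + B * x (2 * (n + 1)) + C * x (2 * n + 1)) := fun n => hrec (2 * n + 1)
    simp only [e]
    exact (((hφ'.const_mul β).const_add α).add (hψ.const_mul γ)).div
      (((hφ'.const_mul B).const_add A).add (hψ.const_mul C)) (hden _ _ hφ0 hψ0).ne'
  by_cases hne : φ = ψ
  · left
    subst hne
    rw [eq_div_iff (hden _ _ hφ0 hφ0).ne'] at eφ
    have h1 : 0 < (B + C) * xbar + A - β - γ := by
      refine pos_of_mul_pos_right (a := xbar) ?_ hxbar_pos.le
      linarith
    have h2 : (φ - xbar) * ((B + C) * φ + ((B + C) * xbar + A - β - γ)) = 0 := by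
      linear_combination eφ - hxbar_eq
    have h3 : φ - xbar = 0 := (mul_eq_zero.1 h2).resolve_right (by positivity)
    rw [← sub_eq_zero.1 h3]
    exact tendsto_of_tendsto_even_odd hφ hψ
  · exact .inr ⟨φ, ψ, hne, hφ0, hψ0, eφ, eψ, .inl ⟨hφ, hψ⟩⟩
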